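/- (Corollary 1, soft-min version: a priori feasibility threshold for the smoothed backup CBF.) Let F_b : ℝⁿ → ℝⁿ be continuous, and let φ : ℝ × ℝⁿ → ℝⁿ be a continuous map satisfying the flow laws φ(0,x) = x, φ(s, φ(t,x)) = φ(s+t,x), such that s ↦ φ(s,x) is differentiable at 0 with derivative F_b(x) for every x, and x ↦ φ(t,x) is continuously differentiable for every t. Let h, h_b : ℝⁿ → ℝ be continuously differentiable, S_b := {h_b ≥ 0} compact, T ≥ 0, τ_1,…,τ_{N−1} ∈ [0,T], b_i(x) := h(φ(τ_i,x)) for i < N, b_N(x) := h_b(φ(T,x)), and for θ > 0 let b̃_θ(x) := −(1/θ)·log(∑_{i=1}^N exp(−θ·b_i(x))). Assume: (i) for every y ∈ S_b and s > 0, φ(s,y) ∈ interior(S_b); (ii) for every y with h_b(y) = 0, L_{F_b} h_b(y) > 0; (iii) for every y with h(y) = 0 and φ(T,y) ∈ S_b, L_{F_b} h(y) > 0. Then there exists θ* > 0 such that for every θ > θ* and every x ∈ ℝⁿ with b̃_θ(x) = 0, one has L_{F_b} b̃_θ(x) > 0 (hence D b̃_θ(x) ≠ 0 on the zero level set of b̃_θ).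 -/

import Mathlib

/-- The soft-min (log-sum-exp) `b̃_θ(x) = -(1/θ) log (∑ i, exp (-θ b_i x))`. -/
noncomputable def softmin {n N : ℕ} (θ : ℝ) (b : Fin N → (Fin n → ℝ) → ℝ)
    (x : Fin n → ℝ) : ℝ :=
  -(1 / θ) * Real.log (∑ i, Real.exp (-θ * b i x))

/-- The Lie derivative `L_F g(x) = D g(x)(F(x))` of `g` along the vector field `F`. -/
noncomputable def lieD {n : ℕ} (F : (Fin n → ℝ) → (Fin n → ℝ)) (g : (Fin n → ℝ) → ℝ)
    (x : Fin n → ℝ) : ℝ :=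
  fderiv ℝ g x (F x)

theorem exists_forall_lt_add_mul_abs {X ι : Type*} [TopologicalSpace X] [Finite ι] {K : Set X}
    (hK : IsCompact K) {f g : ι → X → ℝ} (hf : ∀ i, Continuous (f i))
    (hg : ∀ i, Continuous (g i)) (hfg : ∀ x ∈ K, ∀ i, f i x = 0 → 0 < g i x) :
    ∃ c > (0:ℝ), ∃ C : ℝ, 0 ≤ C ∧ ∀ x ∈ K, ∀ i, c < g i x + C * |f i x| := by
  have hlim : Filter.Tendsto (fun k : ℕ => 1 / ((k:ℝ) + 1)) Filter.atTop (nhds 0) :=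
    tendsto_one_div_add_atTop_nhds_zero_nat
  let U : ℕ → Set X := fun k => {x | ∀ i, 1 / ((k:ℝ) + 1) < g i x + k * |f i x|}
  have hUo : ∀ k, IsOpen (U k) := fun k => by
    have hUk : U k = ⋂ i, {x | 1 / ((k:ℝ) + 1) < g i x + k * |f i x|} := by
      ext x; simp [U]
    rw [hUk]
    exact isOpen_iInter_of_finite fun i => isOpen_lt continuous_const
      ((hg i).add (continuous_const.mul (hf i).abs))
  have hUm : Monotone U := fun k l hkl x hx i => by
    have hkl' : (k:ℝ) ≤ l := by exact_mod_cast hkl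
    calc 1 / ((l:ℝ) + 1) ≤ 1 / ((k:ℝ) + 1) := by gcongr
      _ < g i x + k * |f i x| := hx i
      _ ≤ g i x + l * |f i x| := by gcongr
  have hcov : K ⊆ ⋃ k, U k := fun x hx => by
    have hev : ∀ᶠ k : ℕ in Filter.atTop, ∀ i, 1 / ((k:ℝ) + 1) < g i x + k * |f i x| := by
      refine Filter.eventually_all.2 fun i => ?_
      by_cases hi : f i x = 0
      · filter_upwards [hlim.eventually (gt_mem_nhds (hfg x hx i hi))] with k hk
        simpa [hi] using hk
      · have hpos : 0 < |f i x| := abs_pos.2 hi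
        have htop : Filter.Tendsto (fun k : ℕ => g i x + k * |f i x|)
            Filter.atTop Filter.atTop :=
          Filter.tendsto_atTop_add_const_left _ _
            (tendsto_natCast_atTop_atTop.atTop_mul_const hpos)
        filter_upwards [hlim.eventually (gt_mem_nhds one_pos), htop.eventually_gt_atTop 1]
          with k hk hk'
        exact hk.trans hk'
    obtain ⟨k, hk⟩ := hev.exists
    exact Set.mem_iUnion.2 ⟨k, hk⟩
  obtain ⟨k, hk⟩ := hK.elim_directed_cover U hUo hcov hUm.directed_le
  exact ⟨1 / ((k:ℝ) + 1), by positivity, k, by positivity, fun x hx => hk hx⟩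

theorem continuous_lieD {n : ℕ} {F : (Fin n → ℝ) → (Fin n → ℝ)} (hF : Continuous F)
    {g : (Fin n → ℝ) → ℝ} (hg : ContDiff ℝ 1 g) : Continuous (lieD F g) :=
  (hg.continuous_fderiv one_ne_zero).clm_apply hF

/-- The Lie derivative along the generator of a flow commutes with the flow. -/
theorem lieD_comp_flow {n : ℕ} {F : (Fin n → ℝ) → (Fin n → ℝ)}
    {φ : ℝ → (Fin n → ℝ) → (Fin n → ℝ)} (hφ0 : ∀ x, φ 0 x = x)
    (hφadd : ∀ s t : ℝ, ∀ x, φ s (φ t x) = φ (s + t) x)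
    (hderiv0 : ∀ x, HasDerivAt (fun s : ℝ => φ s x) (F x) 0) {t : ℝ}
    (hφt : Differentiable ℝ (φ t)) {g : (Fin n → ℝ) → ℝ} (hg : Differentiable ℝ g)
    (x : Fin n → ℝ) :
    lieD F (fun y => g (φ t y)) x = lieD F g (φ t x) := by
  have hcomp : Differentiable ℝ (fun y => g (φ t y)) := hg.comp hφt
  have h1 : HasDerivAt (fun s : ℝ => g (φ t (φ s x))) (lieD F (fun y => g (φ t y)) x) 0 :=
    (hcomp x).hasFDerivAt.comp_hasDerivAt_of_eq (0:ℝ) (hderiv0 x) (hφ0 x).symm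
  have h2 : HasDerivAt (fun s : ℝ => g (φ s (φ t x))) (lieD F g (φ t x)) 0 :=
    (hg (φ t x)).hasFDerivAt.comp_hasDerivAt_of_eq (0:ℝ) (hderiv0 (φ t x)) (hφ0 _).symm
  have heq : (fun s : ℝ => g (φ t (φ s x))) = fun s : ℝ => g (φ s (φ t x)) := by
    funext s; rw [hφadd, hφadd, add_comm]
  rw [heq] at h1
  exact h1.unique h2

theorem sum_exp_eq_one_of_softmin_eq_zero {n N : ℕ} [NeZero N] {θ : ℝ} (hθ : 0 < θ)
    {b : Fin N → (Fin n → ℝ) → ℝ} {x : Fin n → ℝ} (hx : softmin θ b x = 0) :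
    ∑ i, Real.exp (-θ * b i x) = 1 := by
  have hpos : 0 < ∑ i, Real.exp (-θ * b i x) :=
    Finset.sum_pos (fun i _ => Real.exp_pos _) Finset.univ_nonempty
  have hne : -(1 / θ) ≠ 0 := neg_ne_zero.2 (one_div_pos.2 hθ).ne'
  exact Real.eq_one_of_pos_of_log_eq_zero hpos ((mul_eq_zero.1 hx).resolve_left hne)

theorem nonneg_of_softmin_eq_zero {n N : ℕ} [NeZero N] {θ : ℝ} (hθ : 0 < θ)
    {b : Fin N → (Fin n → ℝ) → ℝ} {x : Fin n → ℝ} (hx : softmin θ b x = 0) (i : Fin N) :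
    0 ≤ b i x := by
  have hle : Real.exp (-θ * b i x) ≤ 1 :=
    (Finset.single_le_sum (f := fun j => Real.exp (-θ * b j x))
      (fun j _ => (Real.exp_pos _).le) (Finset.mem_univ i)).trans_eq
      (sum_exp_eq_one_of_softmin_eq_zero hθ hx)
  have := Real.exp_le_one_iff.1 hle
  nlinarith

theorem lieD_softmin_of_eq_zero {n N : ℕ} [NeZero N] {θ : ℝ} (hθ : 0 < θ)
    (F : (Fin n → ℝ) → (Fin n → ℝ)) {b : Fin N → (Fin n → ℝ) → ℝ}
    {x : Fin n → ℝ} (hb : ∀ i, DifferentiableAt ℝ (b i) x) (hx : softmin θ b x = 0) :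
    lieD F (softmin θ b) x = ∑ i, Real.exp (-θ * b i x) * lieD F (b i) x := by
  have hsum := sum_exp_eq_one_of_softmin_eq_zero hθ hx
  have hd : HasFDerivAt (fun y => ∑ i, Real.exp (-θ * b i y))
      (∑ i, Real.exp (-θ * b i x) • (-θ) • fderiv ℝ (b i) x) x :=
    HasFDerivAt.fun_sum fun i _ => ((hb i).hasFDerivAt.const_mul (-θ)).exp
  have hs : HasFDerivAt (softmin θ b) _ x :=
    (hd.log (by rw [hsum]; exact one_ne_zero)).const_mul (-(1 / θ))
  unfold lieD
  rw [hs.fderiv, hsum]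
  simp only [inv_one, one_smul, smul_apply, sum_apply,
    smul_eq_mul, Finset.mul_sum]
  refine Finset.sum_congr rfl fun i _ => ?_
  field_simp

/-- Corollary 1, soft-min version: for the backup constraints
`b_i(x) = h(φ(τ_i,x))` (`i < N`) and `b_N(x) = h_b(φ(T,x))`, under strict safety of
the compact backup set `S_b = {h_b ≥ 0}` under the backup flow (i), regularity of `0`
for `h_b` along the flow (ii), and strict safety on the backup-reachable boundary
(iii, Assumption 2), there exists `θ* > 0` such that for every `θ > θ*` the smoothed
backup function `b̃_θ` has strictly positive Lie derivative along `F_b` on its zero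
level set (hence `D b̃_θ ≠ 0` there). -/
theorem backup_softmin_threshold {n m : ℕ}
    (Fb : (Fin n → ℝ) → (Fin n → ℝ)) (hFb : Continuous Fb)
    (φ : ℝ → (Fin n → ℝ) → (Fin n → ℝ))
    (hcont : Continuous fun p : ℝ × (Fin n → ℝ) => φ p.1 p.2)
    (hφ0 : ∀ x, φ 0 x = x)
    (hφadd : ∀ s t : ℝ, ∀ x, φ s (φ t x) = φ (s + t) x)
    (hderiv0 : ∀ x, HasDerivAt (fun s : ℝ => φ s x) (Fb x) 0)
    (hφC1 : ∀ t : ℝ, ContDiff ℝ 1 (φ t))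
    (h hb : (Fin n → ℝ) → ℝ) (hhC1 : ContDiff ℝ 1 h) (hhbC1 : ContDiff ℝ 1 hb)
    (hSbcomp : IsCompact {x : Fin n → ℝ | 0 ≤ hb x})
    (T : ℝ) (hT : 0 ≤ T) (τ : Fin m → ℝ) (hτ : ∀ i, τ i ∈ Set.Icc (0:ℝ) T)
    (b : Fin (m + 1) → (Fin n → ℝ) → ℝ)
    (hb_slice : ∀ i : Fin m, b i.castSucc = fun y => h (φ (τ i) y))
    (hb_last : b (Fin.last m) = fun y => hb (φ T y))
    (hsafe : ∀ y : Fin n → ℝ, 0 ≤ hb y → ∀ s : ℝ, 0 < s →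
      φ s y ∈ interior {z : Fin n → ℝ | 0 ≤ hb z})
    (hreg : ∀ y : Fin n → ℝ, hb y = 0 → 0 < lieD Fb hb y)
    (hassump : ∀ y : Fin n → ℝ, h y = 0 → 0 ≤ hb (φ T y) → 0 < lieD Fb h y) :
    ∃ θstar > (0:ℝ), ∀ θ : ℝ, θstar < θ →
      ∀ x : Fin n → ℝ, softmin θ b x = 0 →
        0 < lieD Fb (softmin θ b) x ∧ fderiv ℝ (softmin θ b) x ≠ 0 := by
  set K : Set (Fin n → ℝ) := {x | 0 ≤ hb (φ T x)} with hKdef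
  have hK : IsCompact K := by
    have himg : K = φ (-T) '' {x | 0 ≤ hb x} := by
      ext x
      constructor
      · intro hx
        exact ⟨φ T x, hx, by rw [hφadd, neg_add_cancel, hφ0]⟩
      · rintro ⟨y, hy, rfl⟩
        simpa [hKdef, hφadd, hφ0] using hy
    rw [himg]
    exact hSbcomp.image (hφC1 (-T)).continuous
  have hφd : ∀ t, Differentiable ℝ (φ t) := fun t => (hφC1 t).differentiable one_ne_zero
  have hbC1 : ∀ i, ContDiff ℝ 1 (b i) := by
    refine Fin.lastCases ?_ fun i => ?_
    · rw [hb_last]; exact hhbC1.comp (hφC1 T)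
    · rw [hb_slice]; exact hhC1.comp (hφC1 (τ i))
  have hpos : ∀ x ∈ K, ∀ i, b i x = 0 → 0 < lieD Fb (b i) x := by
    intro x hx
    refine Fin.lastCases ?_ fun i => ?_
    · rw [hb_last,
        lieD_comp_flow hφ0 hφadd hderiv0 (hφd T) (hhbC1.differentiable one_ne_zero)]
      exact hreg _
    · rw [hb_slice,
        lieD_comp_flow hφ0 hφadd hderiv0 (hφd (τ i)) (hhC1.differentiable one_ne_zero)]
      intro h0
      refine hassump _ h0 ?_
      rw [hφadd, add_comm, ← hφadd]
      rcases (hτ i).1.eq_or_lt with ht | ht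
      · rw [← ht, hφ0]; exact hx
      · have hmem := interior_subset (hsafe _ hx _ ht)
        exact hmem
  obtain ⟨c, hc, C, hC, hbound⟩ := exists_forall_lt_add_mul_abs hK
    (fun i => (hbC1 i).continuous) (fun i => continuous_lieD hFb (hbC1 i)) hpos
  refine ⟨C * (m + 1) / c + 1, by positivity, fun θ hθ x hx => ?_⟩
  have hθc : C * (m + 1) / c < θ := by linarith
  have hθ0 : 0 < θ := lt_of_le_of_lt (by positivity) hθc
  have hnn := nonneg_of_softmin_eq_zero hθ0 hx
  have hxK : x ∈ K := by simpa [hKdef, hb_last] using hnn (Fin.last m)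
  have hlie : 0 < lieD Fb (softmin θ b) x := by
    rw [lieD_softmin_of_eq_zero hθ0 Fb
      (fun i => (hbC1 i).differentiable one_ne_zero x) hx]
    have hterm : ∀ i, Real.exp (-θ * b i x) * c - C / θ
        ≤ Real.exp (-θ * b i x) * lieD Fb (b i) x := by
      intro i
      have h1 := hbound x hxK i
      rw [abs_of_nonneg (hnn i)] at h1
      have h2 : b i x * Real.exp (-θ * b i x) ≤ 1 / θ := by
        rw [neg_mul, Real.exp_neg, ← div_eq_mul_inv, div_le_div_iff₀ (Real.exp_pos _) hθ0]
        linarith [Real.add_one_le_exp (θ * b i x)]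
      have h3 : C * (b i x * Real.exp (-θ * b i x)) ≤ C / θ := by
        rw [div_eq_mul_one_div]; gcongr
      have h4 := mul_le_mul_of_nonneg_left h1.le (Real.exp_pos (-θ * b i x)).le
      linarith
    refine lt_of_lt_of_le ?_ (Finset.sum_le_sum fun i _ => hterm i)
    rw [Finset.sum_sub_distrib, ← Finset.sum_mul,
      sum_exp_eq_one_of_softmin_eq_zero hθ0 hx, Finset.sum_const, Finset.card_univ,
      Fintype.card_fin, nsmul_eq_mul, one_mul, sub_pos, ← mul_div_assoc, div_lt_iff₀ hθ0]
    rw [div_lt_iff₀ hc] at hθc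
    push_cast
    linarith
  refine ⟨hlie, fun h0 => hlie.ne' ?_⟩
  simp [lieD, h0]
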